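/- arXiv:1109.0658 — 3 statements merged into one kernel-verified Lean document; each statement's English description precedes it below -/
import Mathlib

section
/- Let a < b be real numbers and 0 < α < 1. For all f, g : [a,b] → ℝ of class C^1 on [a,b] such that the left Riemann–Liouville fractional derivative ({}_a D_x^α g)(x) exists for all x ∈ [a,b] and the integrands below are integrable, ∫_a^b g(x)·({}_x^C D_b^α f)(x) dx = ∫_a^b f(x)·({}_a D_x^α g)(x) dx − [ ({}_a I_x^{1-α} g)(x) · f(x) ]_a^b, where [h(x)]_a^b := h(b) − h(a). -/
open Set MeasureTheory intervalIntegral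

/-- Right Caputo fractional derivative of order `α ∈ (0,1)` of `f`, `C^1` on `[a,b]`:
`(ₓᶜD_b^α f)(x) = -(1/Γ(1-α)) ∫_x^b (t-x)^(-α) f'(t) dt`. -/
noncomputable def rightCaputo (a b α : ℝ) (f : ℝ → ℝ) : ℝ → ℝ := fun x =>
  -((1 / Real.Gamma (1 - α)) *
    ∫ t in x..b, (t - x) ^ (-α) * derivWithin f (Set.Icc a b) t)

/-- Left Riemann–Liouville fractional integral of order `1-α`:
`(ₐIₓ^{1-α} g)(x) = (1/Γ(1-α)) ∫_a^x (x-t)^(-α) g(t) dt`. -/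
noncomputable def rlIntLeft (a α : ℝ) (g : ℝ → ℝ) : ℝ → ℝ := fun x =>
  (1 / Real.Gamma (1 - α)) * ∫ t in a..x, (x - t) ^ (-α) * g t

/-- Left Riemann–Liouville fractional derivative of order `α ∈ (0,1)`:
`(ₐDₓ^α g)(x) = (d/dx)[(ₐIₓ^{1-α} g)(x)]`. -/
noncomputable def rlDerLeft (a α : ℝ) (g : ℝ → ℝ) : ℝ → ℝ := fun x =>
  deriv (rlIntLeft a α g) x

/-- Fubini for the Abel kernel `(t - x) ^ (-α)` on the triangle `a < x < t ≤ b`. -/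
theorem integral_mul_abel_swap {a b α : ℝ} (hab : a ≤ b) (hα₀ : 0 < α) (hα₁ : α < 1)
    {g h : ℝ → ℝ} (hg : ContinuousOn g (Icc a b)) (hh : ContinuousOn h (Icc a b)) :
    ∫ x in a..b, g x * ∫ t in x..b, (t - x) ^ (-α) * h t
      = ∫ t in a..b, h t * ∫ x in a..t, (t - x) ^ (-α) * g x := by
  set φ : ℝ → ℝ := (Ioc 0 (b - a)).indicator fun u => u ^ (-α) with hφ
  set G : ℝ → ℝ := (Ioc a b).indicator g with hG
  set H : ℝ → ℝ := (Ioc a b).indicator h with hH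
  have φ_int : Integrable φ := by
    rw [hφ, integrable_indicator_iff measurableSet_Ioc,
      ← intervalIntegrable_iff_integrableOn_Ioc_of_le (sub_nonneg.2 hab)]
    exact intervalIntegral.intervalIntegrable_rpow' (by linarith)
  have G_int : Integrable G := by
    rw [hG, integrable_indicator_iff measurableSet_Ioc]
    exact (hg.integrableOn_Icc).mono_set Ioc_subset_Icc_self
  have H_int : Integrable H := by
    rw [hH, integrable_indicator_iff measurableSet_Ioc]
    exact (hh.integrableOn_Icc).mono_set Ioc_subset_Icc_self
  obtain ⟨C, hC⟩ := isCompact_Icc.exists_bound_of_continuousOn hh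
  have H_bdd : ∀ t, ‖H t‖ ≤ max C 0 := by
    intro t
    by_cases ht : t ∈ Ioc a b
    · rw [hH, indicator_of_mem ht]
      exact (hC t (Ioc_subset_Icc_self ht)).trans (le_max_left _ _)
    · rw [hH, indicator_of_notMem ht, norm_zero]
      exact le_max_right _ _
  have kernel_int : Integrable (fun p : ℝ × ℝ => H p.1 * (G p.2 * φ (p.1 - p.2)))
      (volume.prod volume) := by
    refine Integrable.bdd_mul
      (G_int.convolution_integrand (ContinuousLinearMap.mul ℝ ℝ) φ_int)
      (c := max C 0) H_int.aestronglyMeasurable.comp_fst (.of_forall fun p => H_bdd p.1)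
  have swap := integral_integral_swap (f := fun t x => H t * (G x * φ (t - x))) kernel_int
  rw [integral_of_le hab, integral_of_le hab, ← MeasureTheory.integral_indicator measurableSet_Ioc,
    ← MeasureTheory.integral_indicator measurableSet_Ioc]
  refine Eq.trans (integral_congr_ae (.of_forall fun x => ?_))
    (swap.symm.trans (integral_congr_ae (.of_forall fun t => ?_)))
  · by_cases hx : x ∈ Ioc a b
    · simp only [indicator_of_mem hx]
      rw [integral_of_le hx.2, ← MeasureTheory.integral_indicator measurableSet_Ioc,
        ← MeasureTheory.integral_const_mul]
      refine integral_congr_ae (.of_forall fun t => ?_)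
      have hGx : G x = g x := indicator_of_mem hx g
      by_cases ht : t ∈ Ioc x b
      · have h1 : t ∈ Ioc a b := ⟨hx.1.trans ht.1, ht.2⟩
        have h2 : t - x ∈ Ioc 0 (b - a) := ⟨by linarith [ht.1], by linarith [ht.2, hx.1]⟩
        simp only [hφ, hH, hGx, indicator_of_mem ht, indicator_of_mem h1, indicator_of_mem h2]
        ring
      · simp only [indicator_of_notMem ht, hGx]
        by_cases h1 : t ∈ Ioc a b
        · have h2 : t - x ∉ Ioc 0 (b - a) := fun h => ht ⟨by linarith [h.1], h1.2⟩
          simp only [hφ, indicator_of_notMem h2, mul_zero]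
        · simp only [hH, indicator_of_notMem h1, mul_zero, zero_mul]
    · simp [hG, indicator_of_notMem hx]
  · by_cases ht : t ∈ Ioc a b
    · simp only [indicator_of_mem ht]
      rw [integral_of_le ht.1.le, ← MeasureTheory.integral_indicator measurableSet_Ioc,
        ← MeasureTheory.integral_const_mul]
      refine integral_congr_ae (.of_forall fun x => ?_)
      have hHt : H t = h t := indicator_of_mem ht h
      by_cases hx : x ∈ Ioc a t
      · have h1 : x ∈ Ioc a b := ⟨hx.1, hx.2.trans ht.2⟩
        have h2 : φ (t - x) = (t - x) ^ (-α) := by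
          rcases hx.2.eq_or_lt with rfl | hlt
          · simp [hφ, Real.zero_rpow (neg_ne_zero.2 hα₀.ne')]
          · exact indicator_of_mem
              (show t - x ∈ Ioc 0 (b - a) from ⟨by linarith, by linarith [ht.2, hx.1]⟩) _
        simp only [hG, hHt, h2, indicator_of_mem hx, indicator_of_mem h1]
        ring
      · simp only [indicator_of_notMem hx, hHt]
        by_cases h1 : x ∈ Ioc a b
        · have h2 : t - x ∉ Ioc 0 (b - a) := fun h => hx ⟨h1.1, by linarith [h.1]⟩
          simp only [hφ, indicator_of_notMem h2, mul_zero]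
        · simp only [hG, indicator_of_notMem h1, mul_zero, zero_mul]
    · simp [hH, indicator_of_notMem ht]

/-- Integration by parts formula, case `0 < α < 1`:
`∫_a^b g·(ₓᶜD_b^α f) = ∫_a^b f·(ₐDₓ^α g) − [(ₐIₓ^{1-α} g)·f]_a^b`. -/
theorem caputo_integration_by_parts_right_frac_order (a b α : ℝ) (ha : a < b)
    (hα₀ : 0 < α) (hα₁ : α < 1) (f g : ℝ → ℝ)
    (hf : ContDiffOn ℝ 1 f (Set.Icc a b)) (hg : ContDiffOn ℝ 1 g (Set.Icc a b))
    -- the left Riemann–Liouville derivative of `g` exists on `[a,b]`: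
    (hex : ∀ x ∈ Set.Icc a b, DifferentiableAt ℝ (rlIntLeft a α g) x)
    -- integrability of the integrands:
    (hi₁ : IntervalIntegrable (fun x => g x * rightCaputo a b α f x) volume a b)
    (hi₂ : IntervalIntegrable (fun x => f x * rlDerLeft a α g x) volume a b) :
    ∫ x in a..b, g x * rightCaputo a b α f x
      = (∫ x in a..b, f x * rlDerLeft a α g x)
        - (rlIntLeft a α g b * f b - rlIntLeft a α g a * f a) := by
  have hf' : ContinuousOn (derivWithin f (Icc a b)) (Icc a b) :=
    hf.continuousOn_derivWithin (uniqueDiffOn_Icc ha) le_rfl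
  have hF : ContinuousOn (rlIntLeft a α g) (Icc a b) :=
    fun x hx => (hex x hx).continuousAt.continuousWithinAt
  have hi₃ : IntervalIntegrable (fun x => derivWithin f (Icc a b) x * rlIntLeft a α g x)
      volume a b :=
    (hf'.mul hF).intervalIntegrable_of_Icc ha.le
  have parts : ∫ x in a..b, (derivWithin f (Icc a b) x * rlIntLeft a α g x
      + f x * rlDerLeft a α g x) = f b * rlIntLeft a α g b - f a * rlIntLeft a α g a := by
    refine integral_eq_sub_of_hasDerivAt_of_le ha.le (hf.continuousOn.mul hF)
      (fun x hx => ?_) (hi₃.add hi₂)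
    have hx' : x ∈ Icc a b := Ioo_subset_Icc_self hx
    exact (((hf.differentiableOn one_ne_zero x hx').hasDerivWithinAt).hasDerivAt
      (Icc_mem_nhds hx.1 hx.2)).mul (hex x hx').hasDerivAt
  rw [intervalIntegral.integral_add hi₃ hi₂] at parts
  have fubini : ∫ x in a..b, g x * rightCaputo a b α f x
      = -∫ x in a..b, derivWithin f (Icc a b) x * rlIntLeft a α g x := by
    have swap := integral_mul_abel_swap ha.le hα₀ hα₁ hg.continuousOn hf'
    simp only [rightCaputo, rlIntLeft, mul_neg, intervalIntegral.integral_neg,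
      mul_left_comm _ (1 / Real.Gamma (1 - α)), intervalIntegral.integral_const_mul, swap]
  rw [fubini]
  linarith
end

section
/- Let a < b be real numbers and 0 < α < 1. For all f, g : [a,b] → ℝ of class C^1 on [a,b] such that f(a) = f(b) = 0, the left Riemann–Liouville fractional derivative ({}_a D_x^α g)(x) exists for all x ∈ [a,b], and the integrands below are integrable, one has ∫_a^b g(x)·({}_x^C D_b^α f)(x) dx = ∫_a^b f(x)·({}_a D_x^α g)(x) dx. -/
open Set MeasureTheory intervalIntegral

/-- Fubini's theorem for the weakly singular kernel `(t - x) ^ (-α)` on a triangle. -/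
theorem integral_mul_integral_rpow_sub_swap {a b α : ℝ} (hab : a ≤ b) (hα₀ : 0 < α) (hα₁ : α < 1)
    {u v : ℝ → ℝ} (hu : ContinuousOn u (Icc a b)) (hv : ContinuousOn v (Icc a b)) :
    ∫ t in a..b, u t * ∫ x in a..t, (t - x) ^ (-α) * v x
      = ∫ x in a..b, v x * ∫ t in x..b, (t - x) ^ (-α) * u t := by
  set k : ℝ → ℝ := (Ioc 0 (b - a)).indicator fun s => s ^ (-α) with hk
  set U : ℝ → ℝ := (Ioc a b).indicator u with hU
  set V : ℝ → ℝ := (Ioc a b).indicator v with hV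
  have hkint : Integrable k := by
    rw [hk, integrable_indicator_iff measurableSet_Ioc,
      ← intervalIntegrable_iff_integrableOn_Ioc_of_le (sub_nonneg.2 hab)]
    exact intervalIntegrable_rpow' (by linarith)
  have hVint : Integrable V := by
    rw [hV, integrable_indicator_iff measurableSet_Ioc]
    exact hv.integrableOn_Icc.mono_set Ioc_subset_Icc_self
  have hUint : Integrable U := by
    rw [hU, integrable_indicator_iff measurableSet_Ioc]
    exact hu.integrableOn_Icc.mono_set Ioc_subset_Icc_self
  obtain ⟨C, hC⟩ := isCompact_Icc.exists_bound_of_continuousOn hu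
  have hUbound : ∀ t, ‖U t‖ ≤ |C| := by
    intro t
    by_cases ht : t ∈ Ioc a b
    · rw [hU, indicator_of_mem ht]
      exact (hC t (Ioc_subset_Icc_self ht)).trans (le_abs_self C)
    · rw [hU, indicator_of_notMem ht]
      simp
  have hint : Integrable (fun p : ℝ × ℝ => U p.1 * (V p.2 * k (p.1 - p.2)))
      (volume.prod volume) := by
    have h := hVint.convolution_integrand (ContinuousLinearMap.mul ℝ ℝ) hkint
    exact h.bdd_mul hUint.aestronglyMeasurable.comp_fst (ae_of_all _ fun p => hUbound p.1)
  have hker : ∀ t ∈ Ioc a b, ∀ x ∈ Ioc a b,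
      k (t - x) = if x ≤ t then (t - x) ^ (-α) else 0 := by
    intro t ht x hx
    have h0 : (0 : ℝ) ^ (-α) = 0 := Real.zero_rpow (by linarith)
    rcases lt_trichotomy x t with h | h | h
    · rw [hk, indicator_of_mem (mem_Ioc.2 ⟨by linarith, by linarith [ht.2, hx.1]⟩), if_pos h.le]
    · subst h
      simp [hk, h0]
    · rw [hk, indicator_of_notMem (fun hm => by linarith [hm.1]), if_neg h.not_ge]
  have hleft : ∫ t in a..b, u t * ∫ x in a..t, (t - x) ^ (-α) * v x
      = ∫ t, ∫ x, U t * (V x * k (t - x)) := by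
    rw [integral_of_le hab, ← MeasureTheory.integral_indicator measurableSet_Ioc]
    congr 1 with t
    rw [MeasureTheory.integral_const_mul]
    by_cases ht : t ∈ Ioc a b
    · rw [indicator_of_mem ht, hU, indicator_of_mem ht, integral_of_le ht.1.le,
        ← MeasureTheory.integral_indicator measurableSet_Ioc]
      congr 2 with x
      by_cases hx : x ∈ Ioc a b
      · rw [hV, indicator_of_mem hx, hker t ht x hx]
        by_cases h : x ≤ t
        · rw [indicator_of_mem (mem_Ioc.2 ⟨hx.1, h⟩), if_pos h, mul_comm]
        · rw [indicator_of_notMem (fun hm => h hm.2), if_neg h, mul_zero]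
      · rw [hV, indicator_of_notMem hx,
          indicator_of_notMem (fun hm => hx ⟨hm.1, hm.2.trans ht.2⟩), zero_mul]
    · rw [indicator_of_notMem ht, hU, indicator_of_notMem ht, zero_mul]
  have hright : ∫ x in a..b, v x * ∫ t in x..b, (t - x) ^ (-α) * u t
      = ∫ x, ∫ t, U t * (V x * k (t - x)) := by
    rw [integral_of_le hab, ← MeasureTheory.integral_indicator measurableSet_Ioc]
    congr 1 with x
    simp_rw [mul_left_comm (U _)]
    rw [MeasureTheory.integral_const_mul]
    by_cases hx : x ∈ Ioc a b
    · rw [indicator_of_mem hx, hV, indicator_of_mem hx, integral_of_le hx.2,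
        ← MeasureTheory.integral_indicator measurableSet_Ioc]
      congr 2 with t
      by_cases ht : t ∈ Ioc a b
      · rw [hU, indicator_of_mem ht, hker t ht x hx]
        rcases lt_trichotomy x t with h | h | h
        · rw [indicator_of_mem (mem_Ioc.2 ⟨h, ht.2⟩), if_pos h.le, mul_comm]
        · subst h
          simp [Real.zero_rpow (show -α ≠ 0 by linarith)]
        · rw [indicator_of_notMem (fun hm => by linarith [hm.1]), if_neg h.not_ge, mul_zero]
      · rw [hU, indicator_of_notMem ht,
          indicator_of_notMem (fun hm => ht ⟨hx.1.trans hm.1, hm.2⟩), zero_mul]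
    · rw [indicator_of_notMem hx, hV, indicator_of_notMem hx, zero_mul]
  rw [hleft, hright]
  exact MeasureTheory.integral_integral_swap hint

/-- Integration by parts without boundary terms, case `0 < α < 1`, `f(a) = f(b) = 0`:
`∫_a^b g·(ₓᶜD_b^α f) = ∫_a^b f·(ₐDₓ^α g)`. -/
theorem caputo_integration_by_parts_right_zero_boundary (a b α : ℝ) (ha : a < b)
    (hα₀ : 0 < α) (hα₁ : α < 1) (f g : ℝ → ℝ)
    (hf : ContDiffOn ℝ 1 f (Set.Icc a b)) (hg : ContDiffOn ℝ 1 g (Set.Icc a b))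
    (hfa : f a = 0) (hfb : f b = 0)
    -- the left Riemann–Liouville derivative of `g` exists on `[a,b]`:
    (hex : ∀ x ∈ Set.Icc a b, DifferentiableAt ℝ (rlIntLeft a α g) x)
    -- integrability of the integrands:
    (hi₁ : IntervalIntegrable (fun x => g x * rightCaputo a b α f x) volume a b)
    (hi₂ : IntervalIntegrable (fun x => f x * rlDerLeft a α g x) volume a b) :
    ∫ x in a..b, g x * rightCaputo a b α f x
      = ∫ x in a..b, f x * rlDerLeft a α g x := by
  set f' := derivWithin f (Icc a b) with hf'
  have hf'c : ContinuousOn f' (Icc a b) :=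
    hf.continuousOn_derivWithin (uniqueDiffOn_Icc ha) le_rfl
  have hGc : ContinuousOn (rlIntLeft a α g) (Icc a b) := fun x hx =>
    (hex x hx).continuousAt.continuousWithinAt
  have hfG : IntervalIntegrable (fun x => f' x * rlIntLeft a α g x) volume a b :=
    (hf'c.mul hGc).intervalIntegrable_of_Icc ha.le
  have hparts : ∫ x in a..b, (f' x * rlIntLeft a α g x + f x * rlDerLeft a α g x) = 0 := by
    have h := integral_eq_sub_of_hasDerivAt_of_le ha.le (hf.continuousOn.mul hGc)
      (fun x hx => ?_) (hfG.add hi₂)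
    · simpa [hfa, hfb] using h
    · have hfx : HasDerivAt f (f' x) x :=
        ((hf.differentiableOn one_ne_zero x
          (Ioo_subset_Icc_self hx)).hasDerivWithinAt).hasDerivAt (Icc_mem_nhds hx.1 hx.2)
      exact hfx.mul (hex x (Ioo_subset_Icc_self hx)).hasDerivAt
  rw [integral_add hfG hi₂] at hparts
  have hswap : ∫ x in a..b, g x * rightCaputo a b α f x
      = -∫ x in a..b, f' x * rlIntLeft a α g x := by
    have h := integral_mul_integral_rpow_sub_swap ha.le hα₀ hα₁ hf'c hg.continuousOn
    simp only [rightCaputo, rlIntLeft, mul_neg, mul_left_comm _ (1 / Real.Gamma (1 - α)),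
      intervalIntegral.integral_neg, intervalIntegral.integral_const_mul, ← hf', h]
  linarith
end

section
/- (Natural boundary condition for fixed terminal time and free terminal value.) Let a < b, α ∈ (0,1), y_a ∈ ℝ, and let L : [a,b] × ℝ × ℝ → ℝ be of class C^1. Let E' := { y ∈ C^1([a,b]) : y(a) = y_a } (with y(b) free). For y ∈ E' write ({}^C_α[y])(x) := (x, y(x), ({}_a^C D_x^α y)(x)) and J(y) := ∫_a^b L(({}^C_α[y])(x)) dx. Assume that for every y ∈ E' the function x ↦ ∂₃L(({}^C_α[y])(x)) has a continuous right Riemann–Liouville fractional derivative of order α on [a,b]. If y ∈ E' minimizes or maximizes J on E', then: (i) for all x ∈ [a,b], ∂₂L(({}^C_α[y])(x)) + {}_x D_b^α[ t ↦ ∂₃L(({}^C_α[y])(t)) ](x) = 0; and (ii) {}_x I_b^{1-α}[ t ↦ ∂₃L(({}^C_α[y])(t)) ](b) = 0, where the value at x = b is understood as the limit as x → b⁻. -/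
open Set MeasureTheory intervalIntegral Filter Topology

/-- Left Caputo fractional derivative of order `α ∈ (0,1)` of `f`, `C^1` on `[a,b]`:
`(ₐᶜDₓ^α f)(x) = (1/Γ(1-α)) ∫_a^x (x-t)^(-α) f'(t) dt`. -/
noncomputable def capL (a b α : ℝ) (f : ℝ → ℝ) : ℝ → ℝ := fun x =>
  (1 / Real.Gamma (1 - α)) *
    ∫ t in a..x, (x - t) ^ (-α) * derivWithin f (Set.Icc a b) t

/-- Right Riemann–Liouville fractional integral of order `1-α` on `[·,T]`:
`(ₓI_T^{1-α} h)(x) = (1/Γ(1-α)) ∫_x^T (t-x)^(-α) h(t) dt`. -/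
noncomputable def rlIr (T α : ℝ) (h : ℝ → ℝ) : ℝ → ℝ := fun x =>
  (1 / Real.Gamma (1 - α)) * ∫ t in x..T, (t - x) ^ (-α) * h t

/-- Right Riemann–Liouville fractional derivative of order `α ∈ (0,1)`:
`(ₓD_T^α h)(x) = -(d/dx)[(ₓI_T^{1-α} h)(x)]`. -/
noncomputable def rlDr (T α : ℝ) (h : ℝ → ℝ) : ℝ → ℝ := fun x => -deriv (rlIr T α h) x

/-- `∂₂L` along `(ᶜ_α[y])(x) = (x, y(x), (ₐᶜDₓ^α y)(x))`. -/
noncomputable def Q2 (a b α : ℝ) (L : ℝ → ℝ → ℝ → ℝ) (y : ℝ → ℝ) (x : ℝ) : ℝ :=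
  deriv (fun u => L x u (capL a b α y x)) (y x)

/-- `∂₃L` along `(ᶜ_α[y])(x)`. -/
noncomputable def Q3 (a b α : ℝ) (L : ℝ → ℝ → ℝ → ℝ) (y : ℝ → ℝ) (x : ℝ) : ℝ :=
  deriv (fun u => L x (y x) u) (capL a b α y x)

/-- The functional `J(y,T) = ∫_a^T L((ᶜ_α[y])(x)) dx`. -/
noncomputable def JT (a b α : ℝ) (L : ℝ → ℝ → ℝ → ℝ) (y : ℝ → ℝ) (T : ℝ) : ℝ :=
  ∫ x in a..T, L x (y x) (capL a b α y x)

theorem intervalIntegrable_sub_rpow_mul {α a b x : ℝ} {g : ℝ → ℝ} (hα : α < 1)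
    (hg : ContinuousOn g (Icc a b)) (hx : x ∈ Icc a b) :
    IntervalIntegrable (fun t => (x - t) ^ (-α) * g t) volume a x := by
  have h : IntervalIntegrable (fun s : ℝ => s ^ (-α)) volume (x - a) (x - x) :=
    intervalIntegrable_rpow' (by linarith)
  have h' := h.comp_sub_left x
  simp only [sub_sub_cancel] at h'
  refine h'.mul_continuousOn (hg.mono ?_)
  rw [uIcc_of_le hx.1]
  exact Icc_subset_Icc_right hx.2

/-- Rescaling an Abel integral to the unit interval. -/
theorem integral_sub_rpow_mul_eq_unit {α a x : ℝ} (hα : α < 1) (hx : a ≤ x) (g : ℝ → ℝ) :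
    ∫ t in a..x, (x - t) ^ (-α) * g t =
      (x - a) ^ (1 - α) * ∫ s in (0 : ℝ)..1, s ^ (-α) * g (x - (x - a) * s) := by
  have h0 : 0 ≤ x - a := sub_nonneg.2 hx
  have h := smul_integral_comp_sub_mul (a := 0) (b := 1)
    (fun t => (x - t) ^ (-α) * g t) (x - a) x
  simp only [mul_one, mul_zero, sub_zero, sub_sub_cancel, smul_eq_mul] at h
  rw [← h]
  have h2 : ∫ s in (0 : ℝ)..1, ((x - a) * s) ^ (-α) * g (x - (x - a) * s) =
      (x - a) ^ (-α) * ∫ s in (0 : ℝ)..1, s ^ (-α) * g (x - (x - a) * s) := by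
    rw [← intervalIntegral.integral_const_mul]
    refine integral_congr fun s hs => ?_
    rw [uIcc_of_le zero_le_one] at hs
    simp only [Real.mul_rpow h0 hs.1, mul_assoc]
  rw [h2, ← mul_assoc]
  congr 1
  rcases h0.eq_or_lt with h0 | h0
  · rw [← h0, zero_mul, Real.zero_rpow (by linarith)]
  · rw [sub_eq_add_neg 1 α, Real.rpow_add h0, Real.rpow_one]

theorem continuousOn_integral_sub_rpow_mul {α a b : ℝ} {g : ℝ → ℝ} (hab : a ≤ b) (hα : α < 1)
    (hg : ContinuousOn g (Icc a b)) :
    ContinuousOn (fun x => ∫ t in a..x, (x - t) ^ (-α) * g t) (Icc a b) := by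
  obtain ⟨C, hC⟩ := isCompact_Icc.exists_bound_of_continuousOn hg
  set G : ℝ → ℝ := IccExtend hab ((Icc a b).domRestrict g) with hG
  have hGc : Continuous G := (continuousOn_iff_continuous_domRestrict.1 hg).Icc_extend'
  have hGg : ∀ t ∈ Icc a b, G t = g t := fun t ht => IccExtend_of_mem hab _ ht
  have hGb : ∀ t, ‖G t‖ ≤ C := fun t => hC _ (projIcc a b hab t).2
  have hcont : Continuous fun x => ∫ s in (0 : ℝ)..1, s ^ (-α) * G (x - (x - a) * s) := by
    have hint : IntervalIntegrable (fun s : ℝ => s ^ (-α)) volume 0 1 :=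
      intervalIntegrable_rpow' (by linarith)
    refine continuous_of_dominated_interval (bound := fun s => ‖s ^ (-α)‖ * C)
      (fun x => ?_) (fun x => ?_) (hint.norm.mul_const C) ?_
    · exact hint.def'.aestronglyMeasurable.mul
        (hGc.comp (by fun_prop)).aestronglyMeasurable
    · refine Eventually.of_forall fun s _ => ?_
      rw [norm_mul]
      gcongr
      exact hGb _
    · exact Eventually.of_forall fun s _ => by fun_prop
  have hpow : Continuous fun x : ℝ => (x - a) ^ (1 - α) :=
    (by fun_prop : Continuous fun x : ℝ => x - a).rpow_const fun _ => Or.inr (by linarith)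
  refine (hpow.mul hcont).continuousOn.congr fun x hx => ?_
  refine Eq.trans ?_ (integral_sub_rpow_mul_eq_unit hα hx.1 G)
  refine integral_congr fun t ht => ?_
  rw [uIcc_of_le hx.1] at ht
  simp only [hGg t ⟨ht.1, ht.2.trans hx.2⟩]

/-- Fubini's theorem on a triangle for the Abel kernel. -/
theorem integral_mul_integral_sub_rpow_mul {α a b : ℝ} {f g : ℝ → ℝ} (hab : a ≤ b)
    (hα₀ : 0 < α) (hα : α < 1) (hf : ContinuousOn f (Icc a b)) (hg : ContinuousOn g (Icc a b)) :
    ∫ x in a..b, f x * ∫ t in a..x, (x - t) ^ (-α) * g t =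
      ∫ t in a..b, g t * ∫ x in t..b, (x - t) ^ (-α) * f x := by
  set k : ℝ → ℝ := (Ioc 0 (b - a)).indicator fun s => s ^ (-α) with hk
  set F : ℝ → ℝ := (Ioc a b).indicator f with hF
  set G : ℝ → ℝ := (Ioc a b).indicator g with hG
  have h0 : (0 : ℝ) ^ (-α) = 0 := Real.zero_rpow (by linarith)
  have hki : Integrable k := by
    rw [hk, integrable_indicator_iff measurableSet_Ioc]
    exact (intervalIntegrable_iff_integrableOn_Ioc_of_le (sub_nonneg.2 hab)).1
      (intervalIntegrable_rpow' (by linarith))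
  have hi : ∀ {h : ℝ → ℝ}, ContinuousOn h (Icc a b) → Integrable ((Ioc a b).indicator h) :=
    fun hh => (integrable_indicator_iff measurableSet_Ioc).2
      (hh.integrableOn_Icc.mono_set Ioc_subset_Icc_self)
  obtain ⟨C, hC⟩ := isCompact_Icc.exists_bound_of_continuousOn hf
  have hC0 : 0 ≤ C := (norm_nonneg _).trans (hC a (left_mem_Icc.2 hab))
  have hFb : ∀ x, ‖F x‖ ≤ C := fun x => by
    by_cases hx : x ∈ Ioc a b
    · simpa [hF, hx] using hC x (Ioc_subset_Icc_self hx)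
    · simpa [hF, hx] using hC0
  have hint : Integrable (fun p : ℝ × ℝ => F p.1 * (G p.2 * k (p.1 - p.2)))
      (volume.prod volume) :=
    ((hi hg).convolution_integrand (ContinuousLinearMap.mul ℝ ℝ) hki).bdd_mul (c := C)
      (hi hf).aestronglyMeasurable.comp_fst (Eventually.of_forall fun p => hFb p.1)
  have hswap := integral_integral_swap (f := fun x t => F x * (G t * k (x - t))) hint
  have hl : ∫ x in a..b, f x * ∫ t in a..x, (x - t) ^ (-α) * g t =
      ∫ x, ∫ t, F x * (G t * k (x - t)) := by
    rw [integral_of_le hab, ← MeasureTheory.integral_indicator measurableSet_Ioc]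
    congr 1 with x
    rw [MeasureTheory.integral_const_mul]
    by_cases hx : x ∈ Ioc a b
    · simp only [hF, hx, indicator_of_mem]
      rw [integral_of_le hx.1.le, ← MeasureTheory.integral_indicator measurableSet_Ioc]
      congr 2 with t
      have hxb := hx.2
      rcases lt_trichotomy t x with htx | rfl | htx
      · by_cases hta : a < t
        · have h1 : t ∈ Ioc a x := ⟨hta, htx.le⟩
          have h2 : t ∈ Ioc a b := ⟨hta, htx.le.trans hxb⟩
          have h3 : x - t ∈ Ioc 0 (b - a) := ⟨by linarith, by linarith⟩
          rw [indicator_of_mem h1, hG, indicator_of_mem h2, hk, indicator_of_mem h3, mul_comm]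
        · simp [hG, hta]
      · simp [hk, h0, indicator_apply]
      · simp [hk, htx.not_ge, htx.le.not_gt]
    · simp [hF, hx]
  have hr : ∫ t in a..b, g t * ∫ x in t..b, (x - t) ^ (-α) * f x =
      ∫ t, ∫ x, F x * (G t * k (x - t)) := by
    rw [integral_of_le hab, ← MeasureTheory.integral_indicator measurableSet_Ioc]
    congr 1 with t
    simp only [mul_left_comm (F _) (G t)]
    rw [MeasureTheory.integral_const_mul]
    by_cases ht : t ∈ Ioc a b
    · simp only [hG, ht, indicator_of_mem]
      rw [integral_of_le ht.2, ← MeasureTheory.integral_indicator measurableSet_Ioc]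
      congr 2 with x
      have hat := ht.1
      by_cases htx : t < x
      · by_cases hxb : x ≤ b
        · have h1 : x ∈ Ioc t b := ⟨htx, hxb⟩
          have h2 : x ∈ Ioc a b := ⟨hat.trans htx, hxb⟩
          have h3 : x - t ∈ Ioc 0 (b - a) := ⟨by linarith, by linarith⟩
          rw [indicator_of_mem h1, hF, indicator_of_mem h2, hk, indicator_of_mem h3, mul_comm]
        · simp [hF, hxb]
      · simp [hk, htx]
    · simp [hG, ht]
  rw [hl, hr, hswap]

theorem continuousOn_derivWithin_Icc {a b : ℝ} {f : ℝ → ℝ} (hab : a < b)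
    (hf : ContDiffOn ℝ 1 f (Icc a b)) : ContinuousOn (derivWithin f (Icc a b)) (Icc a b) :=
  hf.continuousOn_derivWithin (uniqueDiffOn_Icc hab) le_rfl

theorem continuousOn_capL {a b α : ℝ} {f : ℝ → ℝ} (hab : a < b) (hα : α < 1)
    (hf : ContDiffOn ℝ 1 f (Icc a b)) : ContinuousOn (capL a b α f) (Icc a b) :=
  (continuousOn_integral_sub_rpow_mul hab.le hα
    (continuousOn_derivWithin_Icc hab hf)).const_mul _

theorem capL_add_const_mul {a b α : ℝ} {f g : ℝ → ℝ} (hab : a < b) (hα : α < 1)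
    (hf : ContDiffOn ℝ 1 f (Icc a b)) (hg : ContDiffOn ℝ 1 g (Icc a b)) (ε : ℝ) {x : ℝ}
    (hx : x ∈ Icc a b) :
    capL a b α (fun t => f t + ε * g t) x = capL a b α f x + ε * capL a b α g x := by
  have hderiv : ∀ t ∈ Icc a b, derivWithin (fun t => f t + ε * g t) (Icc a b) t =
      derivWithin f (Icc a b) t + ε * derivWithin g (Icc a b) t := fun t ht =>
    (((hf.differentiableOn one_ne_zero t ht).hasDerivWithinAt).add
      ((hg.differentiableOn one_ne_zero t ht).hasDerivWithinAt.const_mul ε)).derivWithin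
      (uniqueDiffOn_Icc hab t ht)
  have hint : ∫ t in a..x, (x - t) ^ (-α) * derivWithin (fun t => f t + ε * g t) (Icc a b) t =
      (∫ t in a..x, (x - t) ^ (-α) * derivWithin f (Icc a b) t) +
        ε * ∫ t in a..x, (x - t) ^ (-α) * derivWithin g (Icc a b) t := by
    rw [← intervalIntegral.integral_const_mul, ← intervalIntegral.integral_add
      (intervalIntegrable_sub_rpow_mul hα (continuousOn_derivWithin_Icc hab hf) hx)
      ((intervalIntegrable_sub_rpow_mul hα
        (continuousOn_derivWithin_Icc hab hg) hx).const_mul ε)]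
    refine integral_congr fun t ht => ?_
    rw [uIcc_of_le hx.1] at ht
    simp only [hderiv t ⟨ht.1, ht.2.trans hx.2⟩]
    ring
  simp only [capL, hint]
  ring

section Lagrangian

variable {a b : ℝ} {L : ℝ → ℝ → ℝ → ℝ}

theorem hasDerivAt_lagrangian_comp
    (hL : ContDiffOn ℝ 1 (fun p : ℝ × ℝ × ℝ => L p.1 p.2.1 p.2.2)
      (Icc a b ×ˢ (univ : Set (ℝ × ℝ))))
    {x : ℝ} (hx : x ∈ Icc a b) {u c : ℝ → ℝ} {u' c' ε : ℝ}
    (hu : HasDerivAt u u' ε) (hc : HasDerivAt c c' ε) :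
    HasDerivAt (fun s => L x (u s) (c s))
      (fderivWithin ℝ (fun p : ℝ × ℝ × ℝ => L p.1 p.2.1 p.2.2)
        (Icc a b ×ˢ (univ : Set (ℝ × ℝ))) (x, u ε, c ε) (0, u', c')) ε := by
  have hmem : ∀ s, (x, u s, c s) ∈ Icc a b ×ˢ (univ : Set (ℝ × ℝ)) := fun s => ⟨hx, mem_univ _⟩
  have h := (hL.differentiableOn one_ne_zero _ (hmem ε)).hasFDerivWithinAt
  exact HasFDerivWithinAt.comp_hasDerivAt (f := fun s => (x, u s, c s)) ε h
    ((hasDerivAt_const ε x).prodMk (hu.prodMk hc)) (Eventually.of_forall hmem)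

theorem continuousOn_fderivWithin_lagrangian (hab : a < b)
    (hL : ContDiffOn ℝ 1 (fun p : ℝ × ℝ × ℝ => L p.1 p.2.1 p.2.2)
      (Icc a b ×ˢ (univ : Set (ℝ × ℝ)))) :
    ContinuousOn (fderivWithin ℝ (fun p : ℝ × ℝ × ℝ => L p.1 p.2.1 p.2.2)
      (Icc a b ×ˢ (univ : Set (ℝ × ℝ)))) (Icc a b ×ˢ (univ : Set (ℝ × ℝ))) :=
  hL.continuousOn_fderivWithin ((uniqueDiffOn_Icc hab).prod uniqueDiffOn_univ) le_rfl

theorem continuousOn_deriv_lagrangian_snd (hab : a < b)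
    (hL : ContDiffOn ℝ 1 (fun p : ℝ × ℝ × ℝ => L p.1 p.2.1 p.2.2)
      (Icc a b ×ˢ (univ : Set (ℝ × ℝ))))
    {u c : ℝ → ℝ} (hu : ContinuousOn u (Icc a b)) (hc : ContinuousOn c (Icc a b)) :
    ContinuousOn (fun x => deriv (fun s => L x s (c x)) (u x)) (Icc a b) := by
  refine (((continuousOn_fderivWithin_lagrangian hab hL).comp
    (continuousOn_id.prodMk (hu.prodMk hc)) fun x hx => ⟨hx, mem_univ _⟩).clm_apply
    (continuousOn_const (c := ((0 : ℝ), (1 : ℝ), (0 : ℝ))))).congr fun x hx => ?_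
  exact (hasDerivAt_lagrangian_comp hL hx (hasDerivAt_id (u x))
    (hasDerivAt_const (u x) (c x))).deriv

theorem continuousOn_deriv_lagrangian_thd (hab : a < b)
    (hL : ContDiffOn ℝ 1 (fun p : ℝ × ℝ × ℝ => L p.1 p.2.1 p.2.2)
      (Icc a b ×ˢ (univ : Set (ℝ × ℝ))))
    {u c : ℝ → ℝ} (hu : ContinuousOn u (Icc a b)) (hc : ContinuousOn c (Icc a b)) :
    ContinuousOn (fun x => deriv (fun s => L x (u x) s) (c x)) (Icc a b) := by
  refine (((continuousOn_fderivWithin_lagrangian hab hL).comp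
    (continuousOn_id.prodMk (hu.prodMk hc)) fun x hx => ⟨hx, mem_univ _⟩).clm_apply
    (continuousOn_const (c := ((0 : ℝ), (0 : ℝ), (1 : ℝ))))).congr fun x hx => ?_
  exact (hasDerivAt_lagrangian_comp hL hx (hasDerivAt_const (c x) (u x))
    (hasDerivAt_id (c x))).deriv

/-- The first variation of an integral functional with a `C^1` Lagrangian. -/
theorem hasDerivAt_integral_lagrangian (hab : a < b)
    (hL : ContDiffOn ℝ 1 (fun p : ℝ × ℝ × ℝ => L p.1 p.2.1 p.2.2)
      (Icc a b ×ˢ (univ : Set (ℝ × ℝ))))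
    {u v c d : ℝ → ℝ} (hu : ContinuousOn u (Icc a b)) (hv : ContinuousOn v (Icc a b))
    (hc : ContinuousOn c (Icc a b)) (hd : ContinuousOn d (Icc a b)) :
    HasDerivAt (fun ε => ∫ x in a..b, L x (u x + ε * v x) (c x + ε * d x))
      (∫ x in a..b, (deriv (fun s => L x s (c x)) (u x) * v x +
        deriv (fun s => L x (u x) s) (c x) * d x)) 0 := by
  set S : Set (ℝ × ℝ × ℝ) := Icc a b ×ˢ (univ : Set (ℝ × ℝ))
  set D := fderivWithin ℝ (fun p : ℝ × ℝ × ℝ => L p.1 p.2.1 p.2.2) S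
  set Φ : ℝ → ℝ → ℝ := fun ε x => D (x, u x + ε * v x, c x + ε * d x) (0, v x, d x) with hΦ
  have hsnd : MapsTo Prod.snd (Icc (-1 : ℝ) 1 ×ˢ Icc a b) (Icc a b) := fun p hp => hp.2
  have hΦc : ContinuousOn (fun p : ℝ × ℝ => Φ p.1 p.2) (Icc (-1) 1 ×ˢ Icc a b) := by
    have hu' := hu.comp continuousOn_snd hsnd
    have hv' := hv.comp continuousOn_snd hsnd
    have hc' := hc.comp continuousOn_snd hsnd
    have hd' := hd.comp continuousOn_snd hsnd
    exact ((continuousOn_fderivWithin_lagrangian hab hL).comp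
      (continuousOn_snd.prodMk ((hu'.add (continuousOn_fst.mul hv')).prodMk
        (hc'.add (continuousOn_fst.mul hd')))) fun p hp => ⟨hp.2, mem_univ _⟩).clm_apply
      (continuousOn_const.prodMk (hv'.prodMk hd'))
  obtain ⟨C, hC⟩ := (isCompact_Icc.prod isCompact_Icc).exists_bound_of_continuousOn hΦc
  have hFc : ∀ ε : ℝ, ContinuousOn (fun x => L x (u x + ε * v x) (c x + ε * d x)) (Icc a b) :=
    fun ε => hL.continuousOn.comp (continuousOn_id.prodMk
      ((hu.add (hv.const_mul ε)).prodMk (hc.add (hd.const_mul ε)))) fun x hx => ⟨hx, mem_univ _⟩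
  have hsub : uIoc a b ⊆ Icc a b := by
    rw [uIoc_of_le hab.le]
    exact Ioc_subset_Icc_self
  have hmeas : ∀ {h : ℝ → ℝ}, ContinuousOn h (Icc a b) →
      AEStronglyMeasurable h (volume.restrict (uIoc a b)) := fun hh =>
    (hh.mono hsub).aestronglyMeasurable measurableSet_uIoc
  have hΦ0 : ContinuousOn (Φ 0) (Icc a b) :=
    hΦc.comp (continuousOn_const.prodMk continuousOn_id) fun x hx => ⟨by simp, hx⟩
  have key := (intervalIntegral.hasDerivAt_integral_of_dominated_loc_of_deriv_le (μ := volume)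
    (bound := fun _ => C) (F' := Φ)
    (F := fun ε x => L x (u x + ε * v x) (c x + ε * d x)) (Icc_mem_nhds (by norm_num : (-1 : ℝ) < 0) one_pos)
    (Eventually.of_forall fun ε => hmeas (hFc ε))
    ((hFc 0).intervalIntegrable_of_Icc hab.le) (hmeas hΦ0)
    (Eventually.of_forall fun x hx ε hε => hC (ε, x) ⟨hε, hsub hx⟩)
    intervalIntegrable_const
    (Eventually.of_forall fun x hx ε _ => hasDerivAt_lagrangian_comp hL (hsub hx)
      ((hasDerivAt_mul_const (v x)).const_add (u x))
      ((hasDerivAt_mul_const (d x)).const_add (c x)))).2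
  refine key.congr_deriv (Eq.symm ?_)
  refine integral_congr fun x hx => ?_
  rw [uIcc_of_le hab.le] at hx
  have h2 := (hasDerivAt_lagrangian_comp hL hx (hasDerivAt_id (u x))
    (hasDerivAt_const (u x) (c x))).deriv
  have h3 := (hasDerivAt_lagrangian_comp hL hx (hasDerivAt_const (c x) (u x))
    (hasDerivAt_id (c x))).deriv
  simp only [id] at h2 h3
  have hsum : ((0 : ℝ), v x, d x) = v x • ((0 : ℝ), (1 : ℝ), (0 : ℝ)) + d x • (0, 0, 1) := by
    simp
  simp only [hΦ, zero_mul, add_zero]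
  rw [h2, h3, hsum, map_add, map_smul, map_smul, smul_eq_mul, smul_eq_mul, mul_comm (v x),
    mul_comm (d x)]

end Lagrangian

/-- Fractional integration by parts against a variation vanishing at `a`. -/
theorem integral_mul_capL {a b α : ℝ} {q η : ℝ → ℝ} (hab : a < b) (hα : α ∈ Ioo (0 : ℝ) 1)
    (hq : ContinuousOn q (Icc a b))
    (hdiff : ∀ x ∈ Icc a b, DifferentiableAt ℝ (rlIr b α q) x)
    (hcont : ContinuousOn (rlDr b α q) (Icc a b))
    (hη : ContDiffOn ℝ 1 η (Icc a b)) (hηa : η a = 0) :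
    ∫ x in a..b, q x * capL a b α η x = ∫ x in a..b, rlDr b α q x * η x := by
  have hη' := continuousOn_derivWithin_Icc hab hη
  have hswap : ∫ x in a..b, q x * capL a b α η x =
      ∫ t in a..b, rlIr b α q t * derivWithin η (Icc a b) t := by
    have h := integral_mul_integral_sub_rpow_mul hab.le hα.1 hα.2 hq hη'
    simp only [capL, rlIr, mul_left_comm (q _), mul_assoc, intervalIntegral.integral_const_mul, h]
    simp only [mul_comm]
  have hab' : uIcc a b = Icc a b := uIcc_of_le hab.le
  have hderiv : ∀ x, deriv (rlIr b α q) x = -rlDr b α q x := fun x => by simp [rlDr]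
  have hparts := integral_mul_deriv_eq_deriv_mul_of_hasDerivAt (a := a) (b := b)
    (u := rlIr b α q) (v := η) (u' := fun x => -rlDr b α q x) (v' := derivWithin η (Icc a b))
    (fun x hx => (hdiff x (hab' ▸ hx)).continuousAt.continuousWithinAt)
    (hab' ▸ hη.continuousOn)
    (fun x hx => by
      rw [min_eq_left hab.le, max_eq_right hab.le] at hx
      exact hderiv x ▸ (hdiff x (Ioo_subset_Icc_self hx)).hasDerivAt)
    (fun x hx => by
      rw [min_eq_left hab.le, max_eq_right hab.le] at hx
      exact (hη.differentiableOn one_ne_zero x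
        (Ioo_subset_Icc_self hx)).hasDerivWithinAt.hasDerivAt (Icc_mem_nhds hx.1 hx.2))
    (hcont.neg.intervalIntegrable_of_Icc hab.le) (hη'.intervalIntegrable_of_Icc hab.le)
  rw [hswap, hparts, hηa]
  simp [rlIr]

/-- The fundamental lemma of the calculus of variations on `[a,b]`. -/
theorem eqOn_zero_of_integral_mul_contDiff_eq_zero {a b : ℝ} {h : ℝ → ℝ} (hab : a < b)
    (hh : ContinuousOn h (Icc a b))
    (H : ∀ η : ℝ → ℝ, ContDiff ℝ 1 η → η a = 0 → ∫ x in a..b, h x * η x = 0) :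
    EqOn h 0 (Icc a b) := by
  have hae : ∀ᵐ x, x ∈ Ioo a b → h x = 0 := by
    refine isOpen_Ioo.ae_eq_zero_of_integral_contDiff_smul_eq_zero
      ((hh.mono Ioo_subset_Icc_self).locallyIntegrableOn measurableSet_Ioo) fun η hη _ hsupp => ?_
    have hout : ∀ x ∉ Ioo a b, η x = 0 := fun x hx =>
      image_eq_zero_of_notMem_tsupport fun hx' => hx (hsupp hx')
    rw [← H η (hη.of_le (by exact_mod_cast le_top)) (hout a (by simp)),
      integral_of_le hab.le, setIntegral_eq_integral_of_forall_compl_eq_zero]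
    · simp only [smul_eq_mul, mul_comm]
    · intro x hx
      rw [hout x fun hx' => hx (Ioo_subset_Ioc_self hx'), mul_zero]
  refine Measure.eqOn_Icc_of_ae_eq volume hab.ne ?_ hh continuousOn_const
  rw [Measure.restrict_congr_set Ioo_ae_eq_Icc.symm]
  exact (ae_restrict_iff' measurableSet_Ioo).2 hae

/-- Natural boundary condition for fixed terminal time `b` and free terminal value
`y(b)`: if `y` minimizes or maximizes `J(y) = ∫_a^b L((ᶜ_α[y])(x)) dx` over
`E' = { y ∈ C¹([a,b]) : y(a) = y_a }`, then the fractional Euler–Lagrange equation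
holds on `[a,b]` together with the transversality condition
`ₓI_b^{1-α}[∂₃L ∘ ᶜ_α[y]](b) = 0` (the value at `x = b` being the limit as `x → b⁻`). -/
theorem fractional_natural_boundary_condition (a b α ya : ℝ) (hab : a < b)
    (hα : α ∈ Set.Ioo (0 : ℝ) 1) (L : ℝ → ℝ → ℝ → ℝ)
    (hL : ContDiffOn ℝ 1 (fun p : ℝ × ℝ × ℝ => L p.1 p.2.1 p.2.2)
      (Set.Icc a b ×ˢ (Set.univ : Set (ℝ × ℝ))))
    -- `∂₃L ∘ ᶜ_α[y]` has a continuous right Riemann–Liouville derivative of order `α`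
    -- on `[a,b]` for every `y ∈ E'`:
    (hD3 : ∀ (y : ℝ → ℝ), ContDiffOn ℝ 1 y (Set.Icc a b) → y a = ya →
      (∀ x ∈ Set.Icc a b, DifferentiableAt ℝ (rlIr b α (Q3 a b α L y)) x) ∧
        ContinuousOn (rlDr b α (Q3 a b α L y)) (Set.Icc a b))
    (y : ℝ → ℝ) (hy : ContDiffOn ℝ 1 y (Set.Icc a b)) (hya : y a = ya)
    (hopt : (∀ z : ℝ → ℝ, ContDiffOn ℝ 1 z (Set.Icc a b) → z a = ya →
              JT a b α L y b ≤ JT a b α L z b) ∨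
            (∀ z : ℝ → ℝ, ContDiffOn ℝ 1 z (Set.Icc a b) → z a = ya →
              JT a b α L z b ≤ JT a b α L y b)) :
    (∀ x ∈ Set.Icc a b, Q2 a b α L y x + rlDr b α (Q3 a b α L y) x = 0) ∧
      Tendsto (rlIr b α (Q3 a b α L y)) (𝓝[<] b) (𝓝 0) := by
  have hα1 := hα.2
  obtain ⟨hdiff, hcont⟩ := hD3 y hy hya
  have hcy := continuousOn_capL hab hα1 hy
  have hQ2 : ContinuousOn (Q2 a b α L y) (Icc a b) :=
    continuousOn_deriv_lagrangian_snd hab hL hy.continuousOn hcy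
  have hQ3 : ContinuousOn (Q3 a b α L y) (Icc a b) :=
    continuousOn_deriv_lagrangian_thd hab hL hy.continuousOn hcy
  constructor
  · refine eqOn_zero_of_integral_mul_contDiff_eq_zero hab (hQ2.add hcont) fun η hη hηa => ?_
    have hη' := hη.contDiffOn (s := Icc a b)
    have hcη := continuousOn_capL hab hα1 hη'
    have hJ : ∀ ε : ℝ, ∫ x in a..b, L x (y x + ε * η x)
        (capL a b α y x + ε * capL a b α η x) = JT a b α L (fun t => y t + ε * η t) b :=
      fun ε => integral_congr fun x hx => by
        rw [uIcc_of_le hab.le] at hx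
        simp only [capL_add_const_mul hab hα1 hy hη' ε hx]
    have hz : ∀ ε : ℝ, ContDiffOn ℝ 1 (fun t => y t + ε * η t) (Icc a b) := fun ε =>
      hy.add (contDiffOn_const.mul hη')
    have hza : ∀ ε : ℝ, y a + ε * η a = ya := fun ε => by rw [hηa, hya, mul_zero, add_zero]
    have hext : IsLocalExtr (fun ε : ℝ => ∫ x in a..b, L x (y x + ε * η x)
        (capL a b α y x + ε * capL a b α η x)) 0 := by
      simp only [hJ]
      refine hopt.imp (fun h => Eventually.of_forall fun ε => ?_)
        (fun h => Eventually.of_forall fun ε => ?_)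
      · simpa using h _ (hz ε) (hza ε)
      · simpa using h _ (hz ε) (hza ε)
    have hfirst : ∫ x in a..b, (Q2 a b α L y x * η x + Q3 a b α L y x * capL a b α η x) = 0 :=
      hext.hasDerivAt_eq_zero
        (hasDerivAt_integral_lagrangian hab hL hy.continuousOn hη'.continuousOn hcy hcη)
    have hiη : ∀ {q : ℝ → ℝ}, ContinuousOn q (Icc a b) →
        IntervalIntegrable (fun x => q x * η x) volume a b := fun hq =>
      (hq.mul hη'.continuousOn).intervalIntegrable_of_Icc hab.le
    have hi3 : IntervalIntegrable (fun x => Q3 a b α L y x * capL a b α η x) volume a b :=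
      (hQ3.mul hcη).intervalIntegrable_of_Icc hab.le
    rw [intervalIntegral.integral_add (hiη hQ2) hi3,
      integral_mul_capL hab hα hQ3 hdiff hcont hη' hηa,
      ← intervalIntegral.integral_add (hiη hQ2) (hiη hcont)] at hfirst
    simpa only [add_mul] using hfirst
  · have h0 : rlIr b α (Q3 a b α L y) b = 0 := by simp [rlIr]
    have h := (hdiff b (right_mem_Icc.2 hab.le)).continuousAt.tendsto
    rw [h0] at h
    exact h.mono_left nhdsWithin_le_nhds
end
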